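/- There are no flat cyclic surfaces in Sol₃ foliated by arcs of circles in the totally geodesic planes x = const. Precisely: let I, J ⊆ ℝ be nonempty open intervals and let a, b, r : I → ℝ be twice continuously differentiable with r(s) > 0 and b(s) − r(s) > 0 for all s ∈ I, and define X : I × J → ℝ³ by X(s,t) = (s, a(s) + r(s)·cos t, log(b(s) + r(s)·sin t)). Then X does not have zero Gaussian curvature, i.e. it is NOT the case that for every (s,t) ∈ I × J and every n ∈ ℝ³ with g_X(n, X_s) = g_X(n, X_t) = 0 one has g_X(S_ss, n)·g_X(S_tt, n) − g_X(S_st, n)² = 0. -/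

import Mathlib

open Real

noncomputable section

/-- Tangent/ambient vectors of Sol₃ modeled on ℝ³. -/
abbrev V3 : Type := ℝ × ℝ × ℝ

/-- The Sol₃ metric at a point `p = (x,y,z)`:
`g_p(u,v) = e^{2z}u₁v₁ + e^{-2z}u₂v₂ + u₃v₃`. -/
def gSol (p u v : V3) : ℝ :=
  exp (2 * p.2.2) * u.1 * v.1 + exp (-(2 * p.2.2)) * u.2.1 * v.2.1 + u.2.2 * v.2.2

/-- The Christoffel bilinear map of the Sol₃ metric at a point `p`. -/
def GammaSol (p u v : V3) : V3 :=
  (u.1 * v.2.2 + u.2.2 * v.1,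
   -(u.2.1 * v.2.2 + u.2.2 * v.2.1),
   -exp (2 * p.2.2) * u.1 * v.1 + exp (-(2 * p.2.2)) * u.2.1 * v.2.1)

/-- Partial derivative of a parametrized surface with respect to the first parameter. -/
def pXs (X : ℝ → ℝ → V3) (s t : ℝ) : V3 := deriv (fun s' => X s' t) s

/-- Partial derivative of a parametrized surface with respect to the second parameter. -/
def pXt (X : ℝ → ℝ → V3) (s t : ℝ) : V3 := deriv (fun t' => X s t') t

/-- Ambient second-order quantity `S_ss = X_ss + Γ_X(X_s, X_s)`. -/
def Sss (X : ℝ → ℝ → V3) (s t : ℝ) : V3 :=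
  deriv (fun s' => pXs X s' t) s + GammaSol (X s t) (pXs X s t) (pXs X s t)

/-- Ambient second-order quantity `S_st = X_st + Γ_X(X_s, X_t)`. -/
def Sst (X : ℝ → ℝ → V3) (s t : ℝ) : V3 :=
  deriv (fun t' => pXs X s t') t + GammaSol (X s t) (pXs X s t) (pXt X s t)

/-- Ambient second-order quantity `S_tt = X_tt + Γ_X(X_t, X_t)`. -/
def Stt (X : ℝ → ℝ → V3) (s t : ℝ) : V3 :=
  deriv (fun t' => pXt X s t') t + GammaSol (X s t) (pXt X s t) (pXt X s t)

/-- `X : I × J → Sol₃` has zero mean curvature: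
for every point of `I × J` and every normal vector `n`,
`E·g(S_tt,n) - 2F·g(S_st,n) + G·g(S_ss,n) = 0`. -/
def MeanZero (I J : Set ℝ) (X : ℝ → ℝ → V3) : Prop :=
  ∀ s ∈ I, ∀ t ∈ J, ∀ n : V3,
    gSol (X s t) n (pXs X s t) = 0 → gSol (X s t) n (pXt X s t) = 0 →
    gSol (X s t) (pXs X s t) (pXs X s t) * gSol (X s t) (Stt X s t) n
      - 2 * gSol (X s t) (pXs X s t) (pXt X s t) * gSol (X s t) (Sst X s t) n
      + gSol (X s t) (pXt X s t) (pXt X s t) * gSol (X s t) (Sss X s t) n = 0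

/-- `X : I × J → Sol₃` has zero Gaussian curvature:
for every point of `I × J` and every normal vector `n`,
`g(S_ss,n)·g(S_tt,n) - g(S_st,n)² = 0`. -/
def GaussZero (I J : Set ℝ) (X : ℝ → ℝ → V3) : Prop :=
  ∀ s ∈ I, ∀ t ∈ J, ∀ n : V3,
    gSol (X s t) n (pXs X s t) = 0 → gSol (X s t) n (pXt X s t) = 0 →
    gSol (X s t) (Sss X s t) n * gSol (X s t) (Stt X s t) n
      - (gSol (X s t) (Sst X s t) n) ^ 2 = 0
/-- The surface of circles of centre `(a s, b s)` and radius `r s` in the planes `x = s`. -/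
def cyclicSurface (a b r : ℝ → ℝ) (s t : ℝ) : V3 :=
  (s, a s + r s * cos t, log (b s + r s * sin t))

theorem add_mul_sin_pos {b r : ℝ} (hr : 0 < r) (hbr : 0 < b - r) (t : ℝ) :
    0 < b + r * sin t := by
  nlinarith [neg_one_le_sin t]

theorem hasDerivAt_cyclicSurface_fst {a b r : ℝ → ℝ} {s a₁ b₁ r₁ : ℝ}
    (ha : HasDerivAt a a₁ s) (hb : HasDerivAt b b₁ s) (hr : HasDerivAt r r₁ s) {t : ℝ}
    (hw : b s + r s * sin t ≠ 0) :
    HasDerivAt (fun s' => cyclicSurface a b r s' t)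
      (1, a₁ + r₁ * cos t, (b₁ + r₁ * sin t) / (b s + r s * sin t)) s :=
  (hasDerivAt_id s).prodMk
    ((ha.add (hr.mul_const _)).prodMk ((hb.add (hr.mul_const _)).log hw))

theorem hasDerivAt_cyclicSurface_snd (a b r : ℝ → ℝ) (s : ℝ) {t : ℝ}
    (hw : b s + r s * sin t ≠ 0) :
    HasDerivAt (cyclicSurface a b r s)
      (0, r s * -sin t, r s * cos t / (b s + r s * sin t)) t :=
  (hasDerivAt_const t s).prodMk
    ((((hasDerivAt_cos t).const_mul (r s)).const_add (a s)).prodMk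
      ((((hasDerivAt_sin t).const_mul (r s)).const_add (b s)).log hw))

theorem exp_two_mul_log {w : ℝ} (hw : 0 < w) : exp (2 * log w) = w ^ 2 := by
  rw [← log_rpow hw, exp_log (by positivity)]
  norm_cast

/-- The flatness equation of a cyclic surface at a point, cleared of denominators: `c` and `S` are
the cosine and the sine of the angle, `a₁, b₁, r₁` and `a₂, b₂, r₂` the first and second derivatives
of `a, b, r`. -/
def flatnessPoly (b r a₁ b₁ r₁ a₂ b₂ r₂ c S : ℝ) : ℝ :=
  b * ((b + r * S) ^ 4 * S + 2 * (c * a₁ + S * b₁ + r₁) * (b₁ + r₁ * S)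
      + 2 * c * (a₁ + r₁ * c) * (b₁ + r₁ * S) + S * (b₁ + r₁ * S) ^ 2 - S * (a₁ + r₁ * c) ^ 2
      - (b + r * S) * (c * a₂ + S * b₂ + r₂))
    - r * ((c * a₁ + S * b₁ + r₁) * c + (a₁ + r₁ * c)) ^ 2

theorem flatnessPoly_eq_zero {I J : Set ℝ} (hIo : IsOpen I) {a b r : ℝ → ℝ}
    (ha : ContDiffOn ℝ 2 a I) (hb : ContDiffOn ℝ 2 b I) (hr : ContDiffOn ℝ 2 r I)
    (hrpos : ∀ s ∈ I, 0 < r s) (hbr : ∀ s ∈ I, 0 < b s - r s)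
    (hflat : GaussZero I J (cyclicSurface a b r)) {s t : ℝ} (hs : s ∈ I) (ht : t ∈ J) :
    flatnessPoly (b s) (r s) (deriv a s) (deriv b s) (deriv r s) (deriv (deriv a) s)
      (deriv (deriv b) s) (deriv (deriv r) s) (cos t) (sin t) = 0 := by
  have hw : ∀ s ∈ I, ∀ t, 0 < b s + r s * sin t := fun s hs t =>
    add_mul_sin_pos (hrpos s hs) (hbr s hs) t
  have first : ∀ {f : ℝ → ℝ}, ContDiffOn ℝ 2 f I → ∀ s ∈ I, HasDerivAt f (deriv f s) s :=
    fun hf s hs => ((hf.contDiffAt (hIo.mem_nhds hs)).differentiableAt (by norm_num)).hasDerivAt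
  have second : ∀ {f : ℝ → ℝ}, ContDiffOn ℝ 2 f I →
      HasDerivAt (deriv f) (deriv (deriv f) s) s := fun hf =>
    (((hf.deriv_of_isOpen hIo (m := 1) (by norm_num)).differentiableOn (by norm_num)).differentiableAt
      (hIo.mem_nhds hs)).hasDerivAt
  have hXs : ∀ s ∈ I, ∀ t, pXs (cyclicSurface a b r) s t =
      (1, deriv a s + deriv r s * cos t,
        (deriv b s + deriv r s * sin t) / (b s + r s * sin t)) := fun s hs t =>
    (hasDerivAt_cyclicSurface_fst (first ha s hs) (first hb s hs) (first hr s hs)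
      (hw s hs t).ne').deriv
  have hXt : ∀ t, pXt (cyclicSurface a b r) s t =
      (0, r s * -sin t, r s * cos t / (b s + r s * sin t)) := fun t =>
    (hasDerivAt_cyclicSurface_snd a b r s (hw s hs t).ne').deriv
  have hXss : deriv (fun s' => pXs (cyclicSurface a b r) s' t) s =
      (0, deriv (deriv a) s + deriv (deriv r) s * cos t,
        ((deriv (deriv b) s + deriv (deriv r) s * sin t) * (b s + r s * sin t)
          - (deriv b s + deriv r s * sin t) * (deriv b s + deriv r s * sin t))
          / (b s + r s * sin t) ^ 2) := by
    have hev : (fun s' => pXs (cyclicSurface a b r) s' t) =ᶠ[nhds s] fun s' =>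
        (1, deriv a s' + deriv r s' * cos t,
          (deriv b s' + deriv r s' * sin t) / (b s' + r s' * sin t)) := by
      filter_upwards [hIo.mem_nhds hs] with s' hs' using hXs s' hs' t
    rw [hev.deriv_eq]
    exact ((hasDerivAt_const s (1 : ℝ)).prodMk
      (((second ha).add ((second hr).mul_const _)).prodMk
        (((second hb).add ((second hr).mul_const _)).div
          ((first hb s hs).add ((first hr s hs).mul_const _)) (hw s hs t).ne'))).deriv
  have hXst : deriv (fun t' => pXs (cyclicSurface a b r) s t') t =
      (0, deriv r s * -sin t,
        (deriv r s * cos t * (b s + r s * sin t) - (deriv b s + deriv r s * sin t) * (r s * cos t))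
          / (b s + r s * sin t) ^ 2) := by
    rw [funext (hXs s hs)]
    exact ((hasDerivAt_const t (1 : ℝ)).prodMk
      ((((hasDerivAt_cos t).const_mul (deriv r s)).const_add (deriv a s)).prodMk
        ((((hasDerivAt_sin t).const_mul (deriv r s)).const_add (deriv b s)).div
          (((hasDerivAt_sin t).const_mul (r s)).const_add (b s)) (hw s hs t).ne'))).deriv
  have hXtt : deriv (fun t' => pXt (cyclicSurface a b r) s t') t =
      (0, r s * -cos t,
        (r s * -sin t * (b s + r s * sin t) - r s * cos t * (r s * cos t))
          / (b s + r s * sin t) ^ 2) := by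
    rw [funext hXt]
    exact ((hasDerivAt_const t (0 : ℝ)).prodMk
      (((hasDerivAt_sin t).neg.const_mul (r s)).prodMk
        (((hasDerivAt_cos t).const_mul (r s)).div
          (((hasDerivAt_sin t).const_mul (r s)).const_add (b s)) (hw s hs t).ne'))).deriv
  have hflat' := hflat s hs t ht
  have hwt := hw s hs t
  have hrs := hrpos s hs
  have hsq := sin_sq_add_cos_sq t
  simp only [Sss, Sst, Stt, hXss, hXst, hXtt, hXs s hs t, hXt t, gSol, GammaSol, cyclicSurface,
    exp_neg, exp_two_mul_log hwt, Prod.mk_add_mk] at hflat'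
  unfold flatnessPoly
  generalize deriv (deriv a) s = a₂, deriv (deriv b) s = b₂, deriv (deriv r) s = r₂,
    deriv a s = a₁, deriv b s = b₁, deriv r s = r₁, sin t = S, cos t = c, b s = β, r s = ρ at *
  obtain ⟨w, hwdef⟩ : ∃ w, w = β + ρ * S := ⟨_, rfl⟩
  simp only [← hwdef] at hwt hflat' ⊢
  have h := hflat' (-(c * a₁ + S * b₁ + r₁), w ^ 4 * c, w ^ 3 * S)
    (by field_simp; linear_combination w ^ 2 * r₁ * hsq) (by field_simp; ring)
  dsimp only at h
  set Q := w ^ 4 * S + 2 * (c * a₁ + S * b₁ + r₁) * (b₁ + r₁ * S)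
    + 2 * c * (a₁ + r₁ * c) * (b₁ + r₁ * S) + S * (b₁ + r₁ * S) ^ 2 - S * (a₁ + r₁ * c) ^ 2
    - w * (c * a₂ + S * b₂ + r₂) with hQ
  have normal_components : ∀ {A B C : ℝ}, A * B - C ^ 2 = 0 → A = -w * Q → B = -w * ρ * β →
      C = -w * ρ * ((c * a₁ + S * b₁ + r₁) * c + (a₁ + r₁ * c)) →
      β * Q - ρ * ((c * a₁ + S * b₁ + r₁) * c + (a₁ + r₁ * c)) ^ 2 = 0 := by
    rintro A B C h rfl rfl rfl
    have hρw : w ^ 2 * ρ ≠ 0 := by positivity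
    refine (mul_eq_zero.mp ?_).resolve_left hρw
    linear_combination h
  refine normal_components h ?_ ?_ ?_
  · rw [hQ]
    field_simp
    linear_combination w * r₂ * hsq
  · field_simp
    linear_combination (-w * ρ + ρ ^ 2 * S) * hsq - ρ * hwdef
  · field_simp
    linear_combination -(ρ * c * r₁ + ρ * a₁) * hsq

theorem flatnessPoly_not_forall_eq_zero {b r : ℝ} (hb : b ≠ 0) (hr : r ≠ 0)
    (a₁ b₁ r₁ a₂ b₂ r₂ : ℝ) :
    ¬ ∀ t, flatnessPoly b r a₁ b₁ r₁ a₂ b₂ r₂ (cos t) (sin t) = 0 := by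
  intro h
  have key : ∀ x : ℝ, -1 ≤ x → x ≤ 1 →
      b * ((b + r * x) ^ 4 * x + 2 * (x * b₁ + r₁) * (b₁ + r₁ * x)
        + 2 * r₁ * (1 - x ^ 2) * (b₁ + r₁ * x) + x * (b₁ + r₁ * x) ^ 2
        - x * (a₁ ^ 2 + r₁ ^ 2 * (1 - x ^ 2)) - (b + r * x) * (x * b₂ + r₂))
      - r * (a₁ ^ 2 * (2 - x ^ 2) ^ 2 + (1 - x ^ 2) * (x * b₁ + 2 * r₁) ^ 2) = 0 := by
    intro x hx hx'
    have h₁ := h (arcsin x)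
    have h₂ := h (π - arcsin x)
    have hsq := sin_sq_add_cos_sq (arcsin x)
    rw [cos_pi_sub, sin_pi_sub] at h₂
    rw [sin_arcsin hx hx'] at h₁ h₂ hsq
    generalize cos (arcsin x) = c at *
    unfold flatnessPoly at h₁ h₂
    have hx4 : 1 - x ^ 2 = c ^ 2 := by linarith
    have hx5 : 2 - x ^ 2 = 1 + c ^ 2 := by linarith
    rw [hx4, hx5]
    linear_combination (h₁ + h₂) / 2
  have h₀ := key (-1) (by norm_num) (by norm_num)
  have h₁ := key (-3 / 5) (by norm_num) (by norm_num)
  have h₂ := key (-1 / 5) (by norm_num) (by norm_num)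
  have h₃ := key (1 / 5) (by norm_num) (by norm_num)
  have h₄ := key (3 / 5) (by norm_num) (by norm_num)
  have h₅ := key 1 (by norm_num) (by norm_num)
  have : b * r ^ 4 = 0 := by
    linear_combination (3125 / 3840) * (h₅ - 5 * h₄ + 10 * h₃ - 10 * h₂ + 5 * h₁ - h₀)
  exact mul_ne_zero hb (pow_ne_zero 4 hr) this

/-- There are no flat cyclic surfaces in Sol₃ foliated by arcs of
circles in the totally geodesic planes `x = const`. -/
theorem no_flat_cyclic_surfaces
    (I J : Set ℝ) (hIo : IsOpen I) (hIne : I.Nonempty) (hIc : I.OrdConnected)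
    (hJo : IsOpen J) (hJne : J.Nonempty) (hJc : J.OrdConnected)
    (a b r : ℝ → ℝ)
    (ha : ContDiffOn ℝ 2 a I) (hb : ContDiffOn ℝ 2 b I) (hr : ContDiffOn ℝ 2 r I)
    (hrpos : ∀ s ∈ I, 0 < r s) (hbr : ∀ s ∈ I, 0 < b s - r s) :
    ¬ GaussZero I J (fun s t => (s, a s + r s * cos t, log (b s + r s * sin t))) := by
  intro hflat
  obtain ⟨s, hs⟩ := hIne
  obtain ⟨t₀, ht₀⟩ := hJne
  have hr0 := hrpos s hs
  have hb0 : 0 < b s := by linarith [hbr s hs]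
  refine flatnessPoly_not_forall_eq_zero hb0.ne' hr0.ne' (deriv a s) (deriv b s) (deriv r s)
    (deriv (deriv a) s) (deriv (deriv b) s) (deriv (deriv r) s) fun t => ?_
  have hana : AnalyticOnNhd ℝ (fun t => flatnessPoly (b s) (r s) (deriv a s) (deriv b s) (deriv r s)
      (deriv (deriv a) s) (deriv (deriv b) s) (deriv (deriv r) s) (cos t) (sin t)) Set.univ := by
    intro t _
    have hc : AnalyticAt ℝ cos t := analyticAt_cos
    have hS : AnalyticAt ℝ sin t := analyticAt_sin
    unfold flatnessPoly
    fun_prop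
  have hzero := hana.eq_of_eventuallyEq (g := fun _ => 0) (z₀ := t₀) (fun _ _ => analyticAt_const)
    (by
      filter_upwards [hJo.mem_nhds ht₀] with t ht
      exact flatnessPoly_eq_zero hIo ha hb hr hrpos hbr hflat hs ht)
  exact congrFun hzero t
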